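/- The best constant in Blecher's inequality is strictly greater than 1: there exist C*-algebras A and B, a nonzero jointly completely bounded bilinear form u : A × B → ℂ, and a constant c > 1 such that for every decomposition u = u₁ + u₂ into completely bounded bilinear forms u₁, u₂ on A × B one has ‖u₁‖_cb + ‖u₂ᵗ‖_cb ≥ c ‖u‖_jcb. -/

import Mathlib

open scoped ComplexOrder

/-- A state on a C*-algebra: a positive continuous linear functional of norm one. -/
def IsState {A : Type*} [NonUnitalCStarAlgebra A] (f : A →L[ℂ] ℂ) : Prop :=
  ‖f‖ = 1 ∧ ∀ a : A, 0 ≤ f (star a * a)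

/-- The (unique) C*-norm of a matrix over a C*-algebra, computed via the action on the
standard Hilbert C*-module `Aⁿ` (whose norm is `‖v‖ = ‖∑ᵢ vᵢ* vᵢ‖^{1/2}`). -/
noncomputable def matCNorm {A : Type*} [NonUnitalCStarAlgebra A]
    {n : Type*} [Fintype n] (x : Matrix n n A) : ℝ :=
  sSup {r : ℝ | ∃ v : n → A, ‖∑ i, star (v i) * v i‖ ≤ 1 ∧
    r = Real.sqrt ‖∑ i, star (x.mulVec v i) * x.mulVec v i‖}

/-- The `n`-th amplification `u_n : M_n(A) × M_n(B) → M_{n²}(ℂ)` of a bilinear form,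
with entries `u_n(x,y)_{(i,k),(j,l)} = u(x_{ij}, y_{kl})`. -/
def jcbAmp {A B : Type*} [NonUnitalCStarAlgebra A] [NonUnitalCStarAlgebra B]
    (u : A →ₗ[ℂ] B →ₗ[ℂ] ℂ) (n : ℕ) (x : Matrix (Fin n) (Fin n) A)
    (y : Matrix (Fin n) (Fin n) B) : Matrix (Fin n × Fin n) (Fin n × Fin n) ℂ :=
  fun p q => u (x p.1 q.1) (y p.2 q.2)

/-- The set of values `‖u_n(x,y)‖` over all `n` and all matrices `x, y` of norm at most one;
its supremum is the jointly completely bounded norm `‖u‖_jcb = sup_n ‖u_n‖`. -/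
def jcbNormSet {A B : Type*} [NonUnitalCStarAlgebra A] [NonUnitalCStarAlgebra B]
    (u : A →ₗ[ℂ] B →ₗ[ℂ] ℂ) : Set ℝ :=
  {r : ℝ | ∃ (n : ℕ) (x : Matrix (Fin n) (Fin n) A) (y : Matrix (Fin n) (Fin n) B),
    matCNorm x ≤ 1 ∧ matCNorm y ≤ 1 ∧ r = matCNorm (jcbAmp u n x y)}

/-- A bilinear form is jointly completely bounded if `sup_n ‖u_n‖ < ∞`. -/
def JointlyCompletelyBounded {A B : Type*} [NonUnitalCStarAlgebra A] [NonUnitalCStarAlgebra B]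
    (u : A →ₗ[ℂ] B →ₗ[ℂ] ℂ) : Prop :=
  BddAbove (jcbNormSet u)

/-- The jointly completely bounded norm `‖u‖_jcb`. -/
noncomputable def jcbNorm {A B : Type*} [NonUnitalCStarAlgebra A] [NonUnitalCStarAlgebra B]
    (u : A →ₗ[ℂ] B →ₗ[ℂ] ℂ) : ℝ :=
  sSup (jcbNormSet u)

/-- The `n`-th Christensen–Sinclair amplification `u_{(n)} : M_n(A) × M_n(B) → M_n(ℂ)` of a
bilinear form, with entries `u_{(n)}(x,y)_{ij} = ∑ₖ u(x_{ik}, y_{kj})`. -/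
noncomputable def cbAmp {A B : Type*} [NonUnitalCStarAlgebra A] [NonUnitalCStarAlgebra B]
    (u : A →ₗ[ℂ] B →ₗ[ℂ] ℂ) (n : ℕ) (x : Matrix (Fin n) (Fin n) A)
    (y : Matrix (Fin n) (Fin n) B) : Matrix (Fin n) (Fin n) ℂ :=
  fun i j => ∑ k, u (x i k) (y k j)

/-- The set of values `‖u_{(n)}(x,y)‖` over all `n` and all matrices `x, y` of norm at most
one; its supremum is the completely bounded norm `‖u‖_cb = sup_n ‖u_{(n)}‖`. -/
def cbNormSet {A B : Type*} [NonUnitalCStarAlgebra A] [NonUnitalCStarAlgebra B]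
    (u : A →ₗ[ℂ] B →ₗ[ℂ] ℂ) : Set ℝ :=
  {r : ℝ | ∃ (n : ℕ) (x : Matrix (Fin n) (Fin n) A) (y : Matrix (Fin n) (Fin n) B),
    matCNorm x ≤ 1 ∧ matCNorm y ≤ 1 ∧ r = matCNorm (cbAmp u n x y)}

/-- A bilinear form is completely bounded (in the Christensen–Sinclair sense) if
`sup_n ‖u_{(n)}‖ < ∞`. -/
def CompletelyBounded {A B : Type*} [NonUnitalCStarAlgebra A] [NonUnitalCStarAlgebra B]
    (u : A →ₗ[ℂ] B →ₗ[ℂ] ℂ) : Prop :=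
  BddAbove (cbNormSet u)

/-- The completely bounded norm `‖u‖_cb`. -/
noncomputable def cbNorm {A B : Type*} [NonUnitalCStarAlgebra A] [NonUnitalCStarAlgebra B]
    (u : A →ₗ[ℂ] B →ₗ[ℂ] ℂ) : ℝ :=
  sSup (cbNormSet u)

theorem cube_eq_one {ω : ℂ} (hω : 1 + ω + ω ^ 2 = 0) : ω ^ 3 = 1 := by
  linear_combination (ω - 1) * hω

open ContinuousLinearMap in
/-- If equality nearly held in the Cauchy-Schwarz bound `6`, then `⟪zₖ, C zₖ⟫` with
`zₖ = V t + ωᵏ W t` and `C = V W*` would be nearly independent of `k`, since `C` commutes with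
every `U k`; but its Fourier coefficient `⟪V t, C W t⟫` is then close to `1`. -/
theorem re_inner_sum_le_of_commute {H : Type*} [NormedAddCommGroup H] [InnerProductSpace ℂ H]
    [CompleteSpace H] (U : Fin 3 → H →L[ℂ] H) (V W : H →L[ℂ] H) (hU : ∀ k, ‖U k‖ ≤ 1)
    (hV : ‖V‖ ≤ 1) (hW : ‖W‖ ≤ 1) (hc : ∀ k, Commute (U k) (V * star W))
    {ω : ℂ} (hω : 1 + ω + ω ^ 2 = 0) (hω' : star ω = ω ^ 2) {t σ : H}
    (ht : ‖t‖ ≤ 1) (hσ : ‖σ‖ ^ 2 = 2) :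
    (inner ℂ σ (∑ k, U k (V t + ω ^ (k : ℕ) • W t))).re ≤ 6 * (1199 / 1200) := by
  by_contra! hlt
  have hω3 := cube_eq_one hω
  have hnω : ‖ω‖ = 1 := Complex.norm_eq_one_of_pow_eq_one hω3 (by norm_num)
  set z : Fin 3 → H := fun k => V t + ω ^ (k : ℕ) • W t with hz
  set C : H →L[ℂ] H := V * star W with hC
  have happ : ∀ (X : H →L[ℂ] H), ‖X‖ ≤ 1 → ∀ v, ‖X v‖ ≤ ‖v‖ := fun X hX v =>
    (X.le_opNorm v).trans (mul_le_of_le_one_left (norm_nonneg _) hX)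
  have hCn : ‖C‖ ≤ 1 := by
    refine (norm_mul_le _ _).trans ?_
    rw [norm_star]
    exact mul_le_one₀ hV (norm_nonneg _) hW
  have hVt := (happ V hV t).trans ht
  have hWt := (happ W hW t).trans ht
  have hzn : ∀ k, ‖z k‖ ≤ 2 := fun k => by
    refine (norm_add_le _ _).trans ?_
    rw [norm_smul, norm_pow, hnω]
    simp only [one_pow, one_mul]
    linarith
  have hexp : ∀ X : H →L[ℂ] H, inner ℂ (z 0) (X (z 0)) + ω ^ 2 * inner ℂ (z 1) (X (z 1))
      + ω * inner ℂ (z 2) (X (z 2)) = 3 * inner ℂ (V t) (X (W t)) := by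
    intro X
    have h2 : (starRingEnd ℂ) ω = ω ^ 2 := hω'
    simp only [hz, map_add, map_smul, inner_add_left, inner_add_right, inner_smul_left,
      inner_smul_right, Fin.val_zero, Fin.val_one, Fin.val_two, map_pow, h2]
    linear_combination (inner ℂ (V t) (X (V t)) + inner ℂ (W t) (X (W t))
      + inner ℂ (W t) (X (V t))) * hω + (2 * inner ℂ (V t) (X (W t))
      + (ω + ω ^ 2) * inner ℂ (W t) (X (V t))
      + (ω + ω ^ 2 + ω ^ 4) * inner ℂ (W t) (X (W t))) * hω3
  have hsum : ∑ k, ‖z k‖ ^ 2 = 3 * (‖V t‖ ^ 2 + ‖W t‖ ^ 2) := by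
    have h1 : ∀ k : Fin 3, ‖z k‖ ^ 2 = ‖V t‖ ^ 2 + ‖W t‖ ^ 2
        + 2 * (ω ^ (k : ℕ) * inner ℂ (V t) (W t)).re := fun k => by
      have h := norm_add_sq (𝕜 := ℂ) (V t) (ω ^ (k : ℕ) • W t)
      rw [inner_smul_right, norm_smul, norm_pow, hnω, one_pow, one_mul] at h
      simp only [hz]
      rw [h, RCLike.re_to_complex]
      ring
    have h2 : ∑ k : Fin 3, (ω ^ (k : ℕ) * inner ℂ (V t) (W t)).re = 0 := by
      rw [← Complex.re_sum, ← Finset.sum_mul, Fin.sum_univ_three]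
      simp [hω]
    simp only [h1]
    rw [Finset.sum_add_distrib, ← Finset.mul_sum, h2]
    simp [mul_add]
  have hre : 6 * (1199 / 1200) < ∑ k, (inner ℂ σ (U k (z k))).re := by
    rwa [← Complex.re_sum, ← inner_sum]
  have hd : ∀ k, ‖σ - U k (z k)‖ ^ 2 ≤ 2 + ‖z k‖ ^ 2 - 2 * (inner ℂ σ (U k (z k))).re := fun k => by
    have h1 := norm_sub_sq (𝕜 := ℂ) σ (U k (z k))
    have h2 : ‖U k (z k)‖ ^ 2 ≤ ‖z k‖ ^ 2 := by gcongr; exact happ _ (hU k) _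
    simp only [RCLike.re_to_complex] at h1
    linarith
  have hd' : ∀ k, ‖z k - star (U k) σ‖ ^ 2 ≤
      2 + ‖z k‖ ^ 2 - 2 * (inner ℂ σ (U k (z k))).re := fun k => by
    have h1 := norm_sub_sq (𝕜 := ℂ) (star (U k) σ) (z k)
    have h2 : ‖star (U k) σ‖ ^ 2 ≤ ‖σ‖ ^ 2 := by
      gcongr; exact happ _ (by rw [norm_star]; exact hU k) _
    rw [star_eq_adjoint, adjoint_inner_left, norm_sub_rev] at h1
    rw [star_eq_adjoint] at h2 ⊢
    simp only [RCLike.re_to_complex] at h1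
    linarith
  have hVW : ‖V t‖ ^ 2 + ‖W t‖ ^ 2 ≤ 2 := by nlinarith [norm_nonneg (V t), norm_nonneg (W t)]
  have hgap : ∀ k, 2 + ‖z k‖ ^ 2 - 2 * (inner ℂ σ (U k (z k))).re ≤ 1 / 100 := by
    have h0 : ∀ k, 0 ≤ 2 + ‖z k‖ ^ 2 - 2 * (inner ℂ σ (U k (z k))).re := fun k =>
      (sq_nonneg _).trans (hd k)
    have h1 : ∑ k, (2 + ‖z k‖ ^ 2 - 2 * (inner ℂ σ (U k (z k))).re) ≤ 1 / 100 := by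
      rw [Finset.sum_sub_distrib, Finset.sum_add_distrib, ← Finset.mul_sum, hsum]
      simp only [Finset.sum_const, Finset.card_univ, Fintype.card_fin]
      norm_num
      linarith
    exact fun k => (Finset.single_le_sum (fun i _ => h0 i) (Finset.mem_univ k)).trans h1
  have hσn : ‖σ‖ ≤ 3 / 2 := by nlinarith [norm_nonneg σ]
  have herr : ∀ k, ‖inner ℂ (z k) (C (z k)) - inner ℂ σ (C σ)‖ ≤ 7 / 20 := by
    intro k
    have e1 : ‖σ - U k (z k)‖ ≤ 1 / 10 := by
      have := (hd k).trans (hgap k)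
      nlinarith [norm_nonneg (σ - U k (z k))]
    have e2 : ‖z k - star (U k) σ‖ ≤ 1 / 10 := by
      have := (hd' k).trans (hgap k)
      nlinarith [norm_nonneg (z k - star (U k) σ)]
    have hcomm : C (U k (z k)) = U k (C (z k)) := by
      have := congrArg (fun X : H →L[ℂ] H => X (z k)) (hc k).eq
      exact this.symm
    have key : inner ℂ (z k) (C (z k)) - inner ℂ σ (C σ) =
        inner ℂ (z k - star (U k) σ) (C (z k)) - inner ℂ σ (C (σ - U k (z k))) := by
      rw [inner_sub_left, map_sub, inner_sub_right, hcomm, star_eq_adjoint, adjoint_inner_left]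
      ring
    rw [key]
    have b1 : ‖inner ℂ (z k - star (U k) σ) (C (z k))‖ ≤ 1 / 10 * 2 :=
      (norm_inner_le_norm _ _).trans (mul_le_mul e2 ((happ C hCn _).trans (hzn k))
        (norm_nonneg _) (by norm_num))
    have b2 : ‖inner ℂ σ (C (σ - U k (z k)))‖ ≤ 3 / 2 * (1 / 10) :=
      (norm_inner_le_norm _ _).trans (mul_le_mul hσn ((happ C hCn _).trans e1)
        (norm_nonneg _) (by norm_num))
    refine (norm_sub_le _ _).trans ?_
    linarith
  have hup : 3 * ‖inner ℂ (V t) (C (W t))‖ ≤ 21 / 20 := by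
    have h1 : 3 * inner ℂ (V t) (C (W t)) =
        (inner ℂ (z 0) (C (z 0)) - inner ℂ σ (C σ))
        + ω ^ 2 * (inner ℂ (z 1) (C (z 1)) - inner ℂ σ (C σ))
        + ω * (inner ℂ (z 2) (C (z 2)) - inner ℂ σ (C σ)) := by
      rw [← hexp C]
      linear_combination inner ℂ σ (C σ) * hω
    have h2 : 3 * ‖inner ℂ (V t) (C (W t))‖ = ‖3 * inner ℂ (V t) (C (W t))‖ := by simp
    rw [h2, h1]
    refine (norm_add₃_le).trans ?_
    rw [norm_mul, norm_mul, norm_pow, hnω]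
    linarith [herr 0, herr 1, herr 2]
  have hlow : 2 - 1 / 300 ≤ ‖V t‖ ^ 2 + ‖W t‖ ^ 2 := by
    have h0 : 0 ≤ ∑ k, (2 + ‖z k‖ ^ 2 - 2 * (inner ℂ σ (U k (z k))).re) :=
      Finset.sum_nonneg fun k _ => (sq_nonneg _).trans (hd k)
    rw [Finset.sum_sub_distrib, Finset.sum_add_distrib, ← Finset.mul_sum, hsum] at h0
    simp only [Finset.sum_const, Finset.card_univ, Fintype.card_fin] at h0
    norm_num at h0
    linarith
  have hnear : ∀ X : H →L[ℂ] H, ‖X‖ ≤ 1 → ‖t - star X (X t)‖ ^ 2 ≤ 1 - ‖X t‖ ^ 2 := by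
    intro X hX
    have h1 := norm_sub_sq (𝕜 := ℂ) t (star X (X t))
    have h2 : ‖star X (X t)‖ ^ 2 ≤ ‖X t‖ ^ 2 := by
      gcongr; exact happ _ (by rw [norm_star]; exact hX) _
    have h3 : ‖t‖ ^ 2 ≤ 1 := by nlinarith [norm_nonneg t]
    rw [star_eq_adjoint, adjoint_inner_right, inner_self_eq_norm_sq] at h1
    rw [star_eq_adjoint] at h2 ⊢
    linarith
  have hdist : ‖star V (V t) - star W (W t)‖ ^ 2 ≤ 1 / 100 := by
    have h1 := hnear V hV
    have h2 := hnear W hW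
    have h3 : ‖star V (V t) - star W (W t)‖ ≤ ‖t - star W (W t)‖ + ‖t - star V (V t)‖ := by
      rw [show star V (V t) - star W (W t) = (t - star W (W t)) - (t - star V (V t)) by abel]
      exact norm_sub_le _ _
    nlinarith [norm_nonneg (star V (V t) - star W (W t)),
      sq_nonneg (‖t - star W (W t)‖ - ‖t - star V (V t)‖)]
  have hinner : inner ℂ (V t) (C (W t)) = inner ℂ (star V (V t)) (star W (W t)) := by
    rw [hC, star_eq_adjoint V, adjoint_inner_left]
    rfl
  have hbig : ∀ X : H →L[ℂ] H, ‖X t‖ ^ 2 ≤ ‖star X (X t)‖ := by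
    intro X
    have h1 := norm_inner_le_norm (𝕜 := ℂ) t (star X (X t))
    rw [star_eq_adjoint, adjoint_inner_right, inner_self_eq_norm_sq_to_K] at h1
    rw [star_eq_adjoint]
    simp at h1
    nlinarith [norm_nonneg (adjoint X (X t))]
  have hfin := norm_sub_sq (𝕜 := ℂ) (star V (V t)) (star W (W t))
  have h5 := RCLike.re_le_norm (inner ℂ (star V (V t)) (star W (W t)))
  rw [hinner] at hup
  have hb1 := hbig V
  have hb2 := hbig W
  nlinarith [sq_nonneg (‖star V (V t)‖ - 1), sq_nonneg (‖star W (W t)‖ - 1)]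

theorem norm_sum_star_mul_self {n : Type*} [Fintype n] (v : n → ℂ) :
    ‖∑ i, star (v i) * v i‖ = ‖WithLp.toLp 2 v‖ ^ 2 := by
  have h : ∑ i, star (v i) * v i = ((∑ i, ‖v i‖ ^ 2 : ℝ) : ℂ) := by
    push_cast
    exact Finset.sum_congr rfl fun i _ => Complex.conj_mul' (v i)
  rw [h, Complex.norm_of_nonneg (by positivity), EuclideanSpace.norm_sq_eq]

theorem sqrt_norm_sum_star_mul_self {n : Type*} [Fintype n] (v : n → ℂ) :
    Real.sqrt ‖∑ i, star (v i) * v i‖ = ‖WithLp.toLp 2 v‖ := by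
  rw [norm_sum_star_mul_self, Real.sqrt_sq (norm_nonneg _)]

theorem norm_toLp_mulVec_le {n : Type*} [Fintype n] [DecidableEq n] (x : Matrix n n ℂ)
    (v : n → ℂ) :
    ‖WithLp.toLp 2 (x.mulVec v)‖ ≤ ‖Matrix.toEuclideanCLM (𝕜 := ℂ) x‖ * ‖WithLp.toLp 2 v‖ := by
  rw [← Matrix.toEuclideanCLM_toLp]
  exact ContinuousLinearMap.le_opNorm _ _

theorem matCNorm_eq_norm_toEuclideanCLM {n : Type*} [Fintype n] [DecidableEq n]
    (x : Matrix n n ℂ) : matCNorm x = ‖Matrix.toEuclideanCLM (𝕜 := ℂ) x‖ := by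
  have hle : ∀ v : n → ℂ, ‖∑ i, star (v i) * v i‖ ≤ 1 →
      Real.sqrt ‖∑ i, star (x.mulVec v i) * x.mulVec v i‖ ≤
        ‖Matrix.toEuclideanCLM (𝕜 := ℂ) x‖ := fun v hv => by
    rw [norm_sum_star_mul_self, sq_le_one_iff₀ (norm_nonneg _)] at hv
    rw [sqrt_norm_sum_star_mul_self]
    exact (norm_toLp_mulVec_le x v).trans (mul_le_of_le_one_right (norm_nonneg _) hv)
  apply le_antisymm
  · refine csSup_le ⟨_, 0, by simp, rfl⟩ ?_
    rintro r ⟨v, hv, rfl⟩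
    exact hle v hv
  · refine ContinuousLinearMap.opNorm_le_of_unit_norm (𝕜 := ℂ)
      (Real.sSup_nonneg ?_) fun v hv => ?_
    · rintro r ⟨v, -, rfl⟩
      exact Real.sqrt_nonneg _
    · refine le_csSup ⟨‖Matrix.toEuclideanCLM (𝕜 := ℂ) x‖, ?_⟩ ⟨v.ofLp, ?_, ?_⟩
      · rintro r ⟨w, hw, rfl⟩
        exact hle w hw
      · rw [norm_sum_star_mul_self]
        simp [hv]
      · rw [sqrt_norm_sum_star_mul_self, ← Matrix.toEuclideanCLM_toLp]

section Pi

variable {ι n : Type*} [Fintype n]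

theorem norm_pi_sum_star_mul_self_le_iff [Fintype ι] (v : n → ι → ℂ) {r : ℝ} (hr : 0 ≤ r) :
    ‖∑ i, star (v i) * v i‖ ≤ r ↔ ∀ k, ‖WithLp.toLp 2 fun i => v i k‖ ^ 2 ≤ r := by
  rw [pi_norm_le_iff_of_nonneg hr]
  refine forall_congr' fun k => ?_
  rw [← norm_sum_star_mul_self]
  simp

theorem pi_mulVec_apply (x : Matrix n n (ι → ℂ)) (v : n → ι → ℂ) (i : n) (k : ι) :
    x.mulVec v i k = (x.map (· k)).mulVec (fun j => v j k) i := by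
  simp [Matrix.mulVec, dotProduct]

variable [Fintype ι] [DecidableEq n]

theorem sqrt_norm_pi_mulVec_le {x : Matrix n n (ι → ℂ)} {r : ℝ} (hr : 0 ≤ r)
    (hx : ∀ k, ‖Matrix.toEuclideanCLM (𝕜 := ℂ) (x.map (· k))‖ ≤ r) {v : n → ι → ℂ}
    (hv : ‖∑ i, star (v i) * v i‖ ≤ 1) :
    Real.sqrt ‖∑ i, star (x.mulVec v i) * x.mulVec v i‖ ≤ r := by
  rw [norm_pi_sum_star_mul_self_le_iff v zero_le_one] at hv
  rw [Real.sqrt_le_left hr, norm_pi_sum_star_mul_self_le_iff _ (sq_nonneg r)]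
  intro k
  simp only [pi_mulVec_apply]
  gcongr
  exact (norm_toLp_mulVec_le _ _).trans ((mul_le_of_le_one_right (norm_nonneg _)
    ((sq_le_one_iff₀ (norm_nonneg _)).1 (hv k))).trans (hx k))

theorem matCNorm_pi_le {x : Matrix n n (ι → ℂ)} {r : ℝ} (hr : 0 ≤ r)
    (hx : ∀ k, ‖Matrix.toEuclideanCLM (𝕜 := ℂ) (x.map (· k))‖ ≤ r) : matCNorm x ≤ r := by
  refine csSup_le ⟨_, 0, by simp, rfl⟩ ?_
  rintro _ ⟨v, hv, rfl⟩
  exact sqrt_norm_pi_mulVec_le hr hx hv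

theorem norm_toEuclideanCLM_map_le_matCNorm (x : Matrix n n (ι → ℂ)) (k : ι) :
    ‖Matrix.toEuclideanCLM (𝕜 := ℂ) (x.map (· k))‖ ≤ matCNorm x := by
  refine ContinuousLinearMap.opNorm_le_of_unit_norm (𝕜 := ℂ)
    (Real.sSup_nonneg ?_) fun v hv => ?_
  · rintro r ⟨v, -, rfl⟩
    exact Real.sqrt_nonneg _
  · have hb : BddAbove {r : ℝ | ∃ v : n → ι → ℂ, ‖∑ i, star (v i) * v i‖ ≤ 1 ∧
        r = Real.sqrt ‖∑ i, star (x.mulVec v i) * x.mulVec v i‖} := by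
      refine ⟨∑ k, ‖Matrix.toEuclideanCLM (𝕜 := ℂ) (x.map (· k))‖, ?_⟩
      rintro _ ⟨w, hw, rfl⟩
      exact sqrt_norm_pi_mulVec_le (by positivity) (fun k => Finset.single_le_sum
        (f := fun k => ‖Matrix.toEuclideanCLM (𝕜 := ℂ) (x.map (· k))‖)
        (fun _ _ => norm_nonneg _) (Finset.mem_univ k)) hw
    refine le_trans ?_ (le_csSup hb ⟨fun i _ => v i, ?_, rfl⟩)
    · refine Real.le_sqrt_of_sq_le ?_
      have := (norm_pi_sum_star_mul_self_le_iff (x.mulVec fun i _ => v i)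
        (norm_nonneg _)).1 le_rfl k
      simp only [pi_mulVec_apply] at this
      rwa [← Matrix.toEuclideanCLM_toLp] at this
    · rw [norm_pi_sum_star_mul_self_le_iff _ zero_le_one]
      simp [hv]

end Pi

theorem norm_entry_le_norm_toEuclideanCLM {n : Type*} [Fintype n] [DecidableEq n]
    (x : Matrix n n ℂ) (i j : n) : ‖x i j‖ ≤ ‖Matrix.toEuclideanCLM (𝕜 := ℂ) x‖ := by
  have h1 := (Matrix.toEuclideanCLM (𝕜 := ℂ) x).le_opNorm (EuclideanSpace.single j 1)
  have h2 := PiLp.norm_apply_le (Matrix.toEuclideanCLM (𝕜 := ℂ) x (EuclideanSpace.single j 1)) i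
  have h3 : Matrix.toEuclideanCLM (𝕜 := ℂ) x (EuclideanSpace.single j 1) i = x i j := by
    simp [Matrix.ofLp_toEuclideanCLM]
  rw [h3] at h2
  simpa using h2.trans h1

/-- The operator norm is at most the Frobenius norm. -/
theorem norm_toEuclideanCLM_le_of_sum_sq_le_one {n : Type*} [Fintype n] [DecidableEq n]
    {x : Matrix n n ℂ} (hx : ∑ i, ∑ j, ‖x i j‖ ^ 2 ≤ 1) :
    ‖Matrix.toEuclideanCLM (𝕜 := ℂ) x‖ ≤ 1 := by
  refine ContinuousLinearMap.opNorm_le_bound _ zero_le_one fun v => ?_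
  rw [one_mul, ← sq_le_sq₀ (norm_nonneg _) (norm_nonneg _), EuclideanSpace.norm_sq_eq,
    EuclideanSpace.norm_sq_eq v]
  calc ∑ i, ‖Matrix.toEuclideanCLM (𝕜 := ℂ) x v i‖ ^ 2
      ≤ ∑ i, (∑ j, ‖x i j‖ ^ 2) * ∑ j, ‖v j‖ ^ 2 := by
        refine Finset.sum_le_sum fun i _ => ?_
        refine le_trans ?_ (Finset.sum_mul_sq_le_sq_mul_sq Finset.univ (‖x i ·‖) (‖v ·‖))
        gcongr
        simp only [Matrix.ofLp_toEuclideanCLM, Matrix.mulVec, dotProduct]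
        exact (norm_sum_le _ _).trans_eq (by simp)
    _ ≤ ∑ j, ‖v j‖ ^ 2 := by
        rw [← Finset.sum_mul]
        exact mul_le_of_le_one_left (by positivity) hx

section Kronecker

open scoped Kronecker

variable {n : Type*} [Fintype n] [DecidableEq n]

theorem norm_toEuclideanCLM_kronecker_one_le (x : Matrix n n ℂ) :
    ‖Matrix.toEuclideanCLM (𝕜 := ℂ) (x ⊗ₖ (1 : Matrix n n ℂ))‖ ≤
      ‖Matrix.toEuclideanCLM (𝕜 := ℂ) x‖ := by
  refine ContinuousLinearMap.opNorm_le_bound _ (norm_nonneg _) fun v => ?_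
  rw [← sq_le_sq₀ (norm_nonneg _) (by positivity), mul_pow, EuclideanSpace.norm_sq_eq,
    EuclideanSpace.norm_sq_eq v, Fintype.sum_prod_type_right, Fintype.sum_prod_type_right,
    Finset.mul_sum]
  refine Finset.sum_le_sum fun k _ => ?_
  have h := norm_toLp_mulVec_le x fun i => v (i, k)
  rw [← sq_le_sq₀ (norm_nonneg _) (by positivity), mul_pow, EuclideanSpace.norm_sq_eq,
    EuclideanSpace.norm_sq_eq] at h
  refine le_trans (le_of_eq ?_) h
  refine Finset.sum_congr rfl fun i _ => ?_
  simp [Matrix.ofLp_toEuclideanCLM, Matrix.mulVec, dotProduct, Fintype.sum_prod_type,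
    Matrix.one_apply]

theorem norm_toEuclideanCLM_one_kronecker_le (x : Matrix n n ℂ) :
    ‖Matrix.toEuclideanCLM (𝕜 := ℂ) ((1 : Matrix n n ℂ) ⊗ₖ x)‖ ≤
      ‖Matrix.toEuclideanCLM (𝕜 := ℂ) x‖ := by
  refine ContinuousLinearMap.opNorm_le_bound _ (norm_nonneg _) fun v => ?_
  rw [← sq_le_sq₀ (norm_nonneg _) (by positivity), mul_pow, EuclideanSpace.norm_sq_eq,
    EuclideanSpace.norm_sq_eq v, Fintype.sum_prod_type, Fintype.sum_prod_type,
    Finset.mul_sum]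
  refine Finset.sum_le_sum fun k _ => ?_
  have h := norm_toLp_mulVec_le x fun i => v (k, i)
  rw [← sq_le_sq₀ (norm_nonneg _) (by positivity), mul_pow, EuclideanSpace.norm_sq_eq,
    EuclideanSpace.norm_sq_eq] at h
  refine le_trans (le_of_eq ?_) h
  refine Finset.sum_congr rfl fun i _ => ?_
  simp [Matrix.ofLp_toEuclideanCLM, Matrix.mulVec, dotProduct, Fintype.sum_prod_type,
    Matrix.one_apply]

end Kronecker

theorem norm_sum_le_of_commute {H : Type*} [NormedAddCommGroup H] [InnerProductSpace ℂ H]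
    [CompleteSpace H] (U : Fin 3 → H →L[ℂ] H) (V W : H →L[ℂ] H) (hU : ∀ k, ‖U k‖ ≤ 1)
    (hV : ‖V‖ ≤ 1) (hW : ‖W‖ ≤ 1) (hc : ∀ k, Commute (U k) (V * star W))
    {ω : ℂ} (hω : 1 + ω + ω ^ 2 = 0) (hω' : star ω = ω ^ 2) :
    ‖∑ k, U k * (V + ω ^ (k : ℕ) • W)‖ ≤ 3 * √2 * (1199 / 1200) := by
  refine ContinuousLinearMap.opNorm_le_of_unit_norm (𝕜 := ℂ) (by positivity) fun t ht => ?_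
  set w := (∑ k, U k * (V + ω ^ (k : ℕ) • W)) t with hw
  have hw' : ∑ k, U k (V t + ω ^ (k : ℕ) • W t) = w := by
    simp [hw]
  rcases eq_or_ne w 0 with h0 | h0
  · rw [h0, norm_zero]
    positivity
  have hpos : 0 < ‖w‖ := norm_pos_iff.2 h0
  have h2 : √2 ^ 2 = 2 := Real.sq_sqrt zero_le_two
  have hσ : ‖((√2 / ‖w‖ : ℝ) : ℂ) • w‖ = √2 := by
    rw [norm_smul, Complex.norm_of_nonneg (by positivity), div_mul_cancel₀ _ hpos.ne']
  have h := re_inner_sum_le_of_commute U V W hU hV hW hc hω hω' ht.le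
    (σ := ((√2 / ‖w‖ : ℝ) : ℂ) • w) (by rw [hσ, h2])
  rw [hw', inner_smul_left, Complex.conj_ofReal, Complex.re_ofReal_mul, ← RCLike.re_to_complex,
    inner_self_eq_norm_sq, div_mul_eq_mul_div, sq, ← mul_assoc,
    mul_div_cancel_right₀ _ hpos.ne'] at h
  nlinarith [Real.sqrt_pos.2 (zero_lt_two' ℝ)]

/-- The form `(a, b) ↦ ∑ₖ aₖ (b₀ + ωᵏ b₁)` on `ℓ^∞₃ × ℓ^∞₂`. -/
noncomputable def rootForm (ω : ℂ) : (Fin 3 → ℂ) →ₗ[ℂ] (Fin 2 → ℂ) →ₗ[ℂ] ℂ :=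
  LinearMap.mk₂ ℂ (fun a b => ∑ k, a k * (b 0 + ω ^ (k : ℕ) * b 1))
    (fun a a' b => by simp [add_mul, Finset.sum_add_distrib])
    (fun c a b => by simp [mul_assoc, Finset.mul_sum])
    (fun a b b' => by
      rw [← Finset.sum_add_distrib]
      exact Finset.sum_congr rfl fun k _ => by simp only [Pi.add_apply]; ring)
    (fun c a b => by
      rw [smul_eq_mul, Finset.mul_sum]
      exact Finset.sum_congr rfl fun k _ => by simp only [Pi.smul_apply, smul_eq_mul]; ring)

theorem rootForm_apply (ω : ℂ) (a : Fin 3 → ℂ) (b : Fin 2 → ℂ) :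
    rootForm ω a b = ∑ k, a k * (b 0 + ω ^ (k : ℕ) * b 1) := rfl

open scoped Kronecker in
theorem jcbAmp_rootForm (ω : ℂ) (n : ℕ) (x : Matrix (Fin n) (Fin n) (Fin 3 → ℂ))
    (y : Matrix (Fin n) (Fin n) (Fin 2 → ℂ)) :
    jcbAmp (rootForm ω) n x y = ∑ k : Fin 3, (x.map (· k) ⊗ₖ (1 : Matrix (Fin n) (Fin n) ℂ)) *
      ((1 : Matrix (Fin n) (Fin n) ℂ) ⊗ₖ y.map (· 0) +
        ω ^ (k : ℕ) • ((1 : Matrix (Fin n) (Fin n) ℂ) ⊗ₖ y.map (· 1))) := by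
  ext p q
  simp only [mul_add, Matrix.mul_smul, ← Matrix.mul_kronecker_mul, Matrix.mul_one,
    Matrix.one_mul, Matrix.sum_apply]
  simp only [jcbAmp, rootForm_apply, Matrix.add_apply, Matrix.smul_apply,
    Matrix.kroneckerMap_apply, Matrix.map_apply, smul_eq_mul]
  exact Finset.sum_congr rfl fun k _ => by ring

open scoped Kronecker in
theorem matCNorm_jcbAmp_rootForm_le {ω : ℂ} (hω : 1 + ω + ω ^ 2 = 0) (hω' : star ω = ω ^ 2)
    {n : ℕ} {x : Matrix (Fin n) (Fin n) (Fin 3 → ℂ)} {y : Matrix (Fin n) (Fin n) (Fin 2 → ℂ)}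
    (hx : matCNorm x ≤ 1) (hy : matCNorm y ≤ 1) :
    matCNorm (jcbAmp (rootForm ω) n x y) ≤ 3 * √2 * (1199 / 1200) := by
  rw [matCNorm_eq_norm_toEuclideanCLM, jcbAmp_rootForm, map_sum]
  simp only [map_mul, map_add, map_smul]
  refine norm_sum_le_of_commute _ _ _ (fun k => ?_) ?_ ?_ (fun k => ?_) hω hω'
  · exact (norm_toEuclideanCLM_kronecker_one_le _).trans
      ((norm_toEuclideanCLM_map_le_matCNorm x k).trans hx)
  · exact (norm_toEuclideanCLM_one_kronecker_le _).trans
      ((norm_toEuclideanCLM_map_le_matCNorm y 0).trans hy)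
  · exact (norm_toEuclideanCLM_one_kronecker_le _).trans
      ((norm_toEuclideanCLM_map_le_matCNorm y 1).trans hy)
  · rw [← map_star, ← map_mul]
    refine Commute.map ?_ _
    rw [Matrix.star_eq_conjTranspose, Matrix.conjTranspose_kronecker, Matrix.conjTranspose_one,
      ← Matrix.mul_kronecker_mul]
    simp only [Commute, SemiconjBy, ← Matrix.mul_kronecker_mul, Matrix.mul_one, Matrix.one_mul]

section LowerBound

variable {ι κ : Type*} [Fintype ι] [Fintype κ]

/-- Testing a completely bounded form on a row times a column. -/
theorem norm_row_mul_column_le_cbNorm {v : (ι → ℂ) →ₗ[ℂ] (κ → ℂ) →ₗ[ℂ] ℂ}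
    (hv : CompletelyBounded v) {a₀ a₁ : ι → ℂ} {b₀ b₁ : κ → ℂ}
    (ha : ∀ k, ‖a₀ k‖ ^ 2 + ‖a₁ k‖ ^ 2 ≤ 1) (hb : ∀ k, ‖b₀ k‖ ^ 2 + ‖b₁ k‖ ^ 2 ≤ 1) :
    ‖v a₀ b₀ + v a₁ b₁‖ ≤ cbNorm v := by
  have hx : matCNorm (!![a₀, a₁; 0, 0] : Matrix (Fin 2) (Fin 2) (ι → ℂ)) ≤ 1 :=
    matCNorm_pi_le zero_le_one fun k =>
      norm_toEuclideanCLM_le_of_sum_sq_le_one (by simpa [Fin.sum_univ_two] using ha k)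
  have hy : matCNorm (!![b₀, 0; b₁, 0] : Matrix (Fin 2) (Fin 2) (κ → ℂ)) ≤ 1 :=
    matCNorm_pi_le zero_le_one fun k =>
      norm_toEuclideanCLM_le_of_sum_sq_le_one (by simpa [Fin.sum_univ_two] using hb k)
  refine le_trans ?_ (le_csSup hv ⟨2, _, _, hx, hy, rfl⟩)
  rw [matCNorm_eq_norm_toEuclideanCLM]
  refine le_trans (le_of_eq ?_) (norm_entry_le_norm_toEuclideanCLM _ 0 0)
  simp [cbAmp, Fin.sum_univ_two]

theorem norm_add_le_cbNorm_add_cbNorm_flip {u u₁ u₂ : (ι → ℂ) →ₗ[ℂ] (κ → ℂ) →ₗ[ℂ] ℂ}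
    (hu : u = u₁ + u₂) (h₁ : CompletelyBounded u₁) (h₂ : CompletelyBounded u₂.flip)
    {a₀ a₁ : ι → ℂ} {b₀ b₁ : κ → ℂ}
    (ha : ∀ k, ‖a₀ k‖ ^ 2 + ‖a₁ k‖ ^ 2 ≤ 1) (hb : ∀ k, ‖b₀ k‖ ^ 2 + ‖b₁ k‖ ^ 2 ≤ 1) :
    ‖u a₀ b₀ + u a₁ b₁‖ ≤ cbNorm u₁ + cbNorm u₂.flip := by
  have h : u a₀ b₀ + u a₁ b₁ =
      (u₁ a₀ b₀ + u₁ a₁ b₁) + (u₂.flip b₀ a₀ + u₂.flip b₁ a₁) := by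
    simp only [hu, LinearMap.add_apply, LinearMap.flip_apply]
    ring
  rw [h]
  refine (norm_add_le _ _).trans ?_
  gcongr
  · exact norm_row_mul_column_le_cbNorm h₁ ha hb
  · exact norm_row_mul_column_le_cbNorm h₂ hb ha

end LowerBound

theorem exists_cube_root : ∃ ω : ℂ, 1 + ω + ω ^ 2 = 0 ∧ star ω = ω ^ 2 := by
  have h3 : √3 * √3 = 3 := Real.mul_self_sqrt (by norm_num)
  refine ⟨⟨-1 / 2, √3 / 2⟩, Complex.ext ?_ ?_, Complex.ext ?_ ?_⟩ <;> simp [sq] <;> linarith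

theorem le_cbNorm_of_rootForm_eq_add {ω : ℂ} (hω : 1 + ω + ω ^ 2 = 0)
    {u₁ u₂ : (Fin 3 → ℂ) →ₗ[ℂ] (Fin 2 → ℂ) →ₗ[ℂ] ℂ} (hu : rootForm ω = u₁ + u₂)
    (h₁ : CompletelyBounded u₁) (h₂ : CompletelyBounded u₂.flip) :
    3 * √2 ≤ cbNorm u₁ + cbNorm u₂.flip := by
  have hω3 := cube_eq_one hω
  have hnω : ‖ω‖ = 1 := Complex.norm_eq_one_of_pow_eq_one hω3 (by norm_num)
  have h2 : √2 ^ 2 = 2 := Real.sq_sqrt zero_le_two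
  have hs : ‖((√2 / 2 : ℝ) : ℂ)‖ = √2 / 2 := Complex.norm_of_nonneg (by positivity)
  refine le_trans (le_of_eq ?_) (norm_add_le_cbNorm_add_cbNorm_flip hu h₁ h₂
    (a₀ := fun _ => ((√2 / 2 : ℝ) : ℂ)) (a₁ := fun k => ((√2 / 2 : ℝ) : ℂ) * ω ^ (2 * (k : ℕ)))
    (b₀ := Pi.single 0 1) (b₁ := Pi.single 1 1) (fun k => ?_) (fun k => ?_))
  · have h : rootForm ω (fun _ => ((√2 / 2 : ℝ) : ℂ)) (Pi.single 0 1) +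
        rootForm ω (fun k => ((√2 / 2 : ℝ) : ℂ) * ω ^ (2 * (k : ℕ))) (Pi.single 1 1) =
        ((3 * √2 : ℝ) : ℂ) := by
      simp [rootForm_apply, Fin.sum_univ_three]
      linear_combination ((√2 : ℂ) / 2) * (ω ^ 3 + 2) * hω3
    rw [h, Complex.norm_of_nonneg (by positivity)]
  · rw [norm_mul, hs, norm_pow, hnω, one_pow, mul_one]
    linarith [div_pow √2 2 2]
  · fin_cases k <;> simp

/-- **The best constant in Blecher's inequality is strictly greater than one**: there are
C*-algebras `A`, `B`, a nonzero jointly completely bounded bilinear form `u : A × B → ℂ` and a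
constant `c > 1` such that every decomposition `u = u₁ + u₂` into completely bounded bilinear
forms satisfies `‖u₁‖_cb + ‖u₂ᵗ‖_cb ≥ c ‖u‖_jcb`. -/
theorem blecher_best_constant_gt_one :
    ∃ (A : Type) (_ : NonUnitalCStarAlgebra A) (B : Type) (_ : NonUnitalCStarAlgebra B)
      (u : A →ₗ[ℂ] B →ₗ[ℂ] ℂ) (c : ℝ),
      u ≠ 0 ∧ JointlyCompletelyBounded u ∧ 1 < c ∧
      ∀ u₁ u₂ : A →ₗ[ℂ] B →ₗ[ℂ] ℂ,
        u = u₁ + u₂ → CompletelyBounded u₁ → CompletelyBounded u₂.flip →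
        c * jcbNorm u ≤ cbNorm u₁ + cbNorm u₂.flip := by
  obtain ⟨ω, hω, hω'⟩ := exists_cube_root
  have hbound : ∀ r ∈ jcbNormSet (rootForm ω), r ≤ 3 * √2 * (1199 / 1200) := by
    rintro _ ⟨n, x, y, hx, hy, rfl⟩
    exact matCNorm_jcbAmp_rootForm_le hω hω' hx hy
  refine ⟨Fin 3 → ℂ, inferInstance, Fin 2 → ℂ, inferInstance, rootForm ω, 1200 / 1199, ?_,
    ⟨_, hbound⟩, by norm_num, fun u₁ u₂ hu h₁ h₂ => ?_⟩
  · intro h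
    have := congrArg (fun v => v (Pi.single 0 1) (Pi.single 0 1)) h
    simp [rootForm_apply] at this
  · have hj : jcbNorm (rootForm ω) ≤ 3 * √2 * (1199 / 1200) :=
      Real.sSup_le hbound (by positivity)
    have := le_cbNorm_of_rootForm_eq_add hω hu h₁ h₂
    linarith
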